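/- Fix N ≥ 1 and let a chain-N-local model be given (N independent sources in a line connecting N+1 parties). If there is a real constant C such that the correlators satisfy ⟨a¹_{x¹} a²_{x²} ⋯ a^{N+1}_{x^{N+1}}⟩ = (−1)^{x¹x² + x²x³ + ⋯ + x^N x^{N+1}} · C for all inputs x¹, …, x^{N+1} ∈ {0,1}, then |C| ≤ 2^{−N}. In particular, correlations of this form with C = V/2^{N/2} cannot be reproduced by any chain-N-local model when V > 2^{−N/2}. -/

import Mathlib

open MeasureTheory

/-- Prepending a coordinate sends the product of the first measure and the product of the
remaining ones to the full product measure. -/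
theorem measurePreserving_finCons {n : ℕ} {Λ : Fin (n + 1) → Type*}
    [∀ i, MeasurableSpace (Λ i)] (ρ : ∀ i, Measure (Λ i)) [∀ i, IsProbabilityMeasure (ρ i)] :
    MeasurePreserving
      (fun q : Λ 0 × (∀ i : Fin n, Λ i.succ) => (Fin.cons q.1 q.2 : ∀ i, Λ i))
      ((ρ 0).prod (Measure.pi fun i : Fin n => ρ i.succ)) (Measure.pi ρ) := by
  have h := (measurePreserving_piFinSuccAbove ρ 0).symm
  have he : (fun q : Λ 0 × (∀ i : Fin n, Λ i.succ) => (Fin.cons q.1 q.2 : ∀ i, Λ i))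
      = (MeasurableEquiv.piFinSuccAbove Λ 0).symm := by
    funext q
    exact (Fin.insertNth_zero (α := Λ) q.1 q.2).symm
  rw [he]
  exact h

theorem integrable_of_abs_le_one {α : Type*} [MeasurableSpace α] {μ : Measure α}
    [IsFiniteMeasure μ] {f : α → ℝ} (hf : Measurable f) (hb : ∀ a, |f a| ≤ 1) :
    Integrable f μ :=
  Integrable.of_bound hf.aestronglyMeasurable 1 (ae_of_all _ hb)

theorem abs_prod_le_one {ι : Type*} (s : Finset ι) {f : ι → ℝ} (hf : ∀ i, |f i| ≤ 1) :
    |∏ i ∈ s, f i| ≤ 1 := by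
  rw [Finset.abs_prod]
  exact Finset.prod_le_one (fun i _ => abs_nonneg _) fun i _ => hf i

/-- The two half-combinations `(a + b) / 2` and `(a - b) / 2` of numbers in `[-1, 1]` have
absolute values summing to at most one. -/
theorem abs_half_add_add_abs_half_sub_le_one {a b : ℝ} (ha : |a| ≤ 1) (hb : |b| ≤ 1) :
    |(a + b) / 2| + |(a - b) / 2| ≤ 1 := by
  rw [abs_le] at ha hb
  rcases abs_cases ((a + b) / 2) with h | h <;> rcases abs_cases ((a - b) / 2) with h' | h' <;>
    linarith

/-- A bound on the mean of `m / p` and `m / q` improves by a factor two to a bound on `m`, since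
`1 / p + 1 / q ≥ 4` for positive `p, q` with `p + q ≤ 1`. -/
theorem abs_le_half_of_abs_div_add_div_le {m p q K : ℝ} (hp : 0 < p) (hq : 0 < q)
    (hpq : p + q ≤ 1) (h : |(m / p + m / q) / 2| ≤ K) : |m| ≤ K / 2 := by
  have hid : (m / p + m / q) / 2 = m * ((p + q) / (2 * (p * q))) := by
    field_simp
    ring
  have hpos : 0 < p * q := mul_pos hp hq
  have h2 : 2 ≤ (p + q) / (2 * (p * q)) := by
    rw [le_div_iff₀ (by positivity)]
    nlinarith [sq_nonneg (p - q), mul_nonneg (add_pos hp hq).le (sub_nonneg.2 hpq)]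
  rw [hid, abs_mul, abs_of_nonneg (by linarith : 0 ≤ (p + q) / (2 * (p * q)))] at h
  nlinarith [abs_nonneg m]

/-- Version of the chain bound suited to induction on the number of sources: responses take
values in `[-1, 1]` and the amplitude may depend on the input of the first party. -/
theorem chain_amplitude_bound :
    ∀ (N : ℕ) (Λ : Fin N → Type) [∀ i, MeasurableSpace (Λ i)]
      (ρ : ∀ i, Measure (Λ i)) [∀ i, IsProbabilityMeasure (ρ i)]
      (A : Fin (N + 1) → Fin 2 → (∀ i, Λ i) → ℝ)
      (_ : ∀ p x, Measurable (A p x))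
      (_ : ∀ p x lam, |A p x lam| ≤ 1)
      (_ : ∀ (p : Fin (N + 1)) (x : Fin 2) (lam lam' : ∀ i, Λ i),
        (∀ i : Fin N, ((i : ℕ) = (p : ℕ) ∨ (i : ℕ) + 1 = (p : ℕ)) → lam i = lam' i) →
        A p x lam = A p x lam')
      (C : Fin 2 → ℝ)
      (_ : ∀ x : Fin (N + 1) → Fin 2,
        (∫ lam, ∏ p, A p (x p) lam ∂(Measure.pi ρ))
          = (-1 : ℝ) ^ (∑ j : Fin N, ((x j.castSucc : ℕ) * (x j.succ : ℕ))) * C (x 0)),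
      |(C 0 + C 1) / 2| ≤ (2 : ℝ)⁻¹ ^ N := by
  intro N
  induction N with
  | zero =>
    intro Λ _ ρ _ A hm hv hl C hc
    have key : ∀ y, |C y| ≤ 1 := by
      intro y
      have h := hc (fun _ => y)
      simp only [Finset.univ_eq_empty, Finset.sum_empty, pow_zero, one_mul] at h
      rw [← h]
      have := norm_integral_le_of_norm_le_const (μ := Measure.pi ρ) (C := 1)
        (f := fun lam => ∏ p, A p y lam)
        (ae_of_all _ fun lam => abs_prod_le_one Finset.univ fun p => hv p y lam)
      simpa using this
    have h0 := abs_le.1 (key 0)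
    have h1 := abs_le.1 (key 1)
    rw [pow_zero, abs_le]
    constructor <;> linarith
  | succ N ih =>
    intro Λ _ ρ _ A hm hv hl C hc
    set m := (C 0 + C 1) / 2 with hmdef
    obtain ⟨t₀⟩ : Nonempty (Λ 0) := nonempty_of_isProbabilityMeasure (ρ 0)
    obtain ⟨u₀⟩ : Nonempty (∀ i : Fin N, Λ i.succ) :=
      nonempty_of_isProbabilityMeasure (Measure.pi fun i : Fin N => ρ i.succ)
    let μ : Measure (∀ i : Fin N, Λ i.succ) := Measure.pi fun i : Fin N => ρ i.succ
    have hcons := measurePreserving_finCons ρ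
    let cons : Λ 0 → (∀ i : Fin N, Λ i.succ) → ∀ i, Λ i := fun t u => Fin.cons t u
    have hcons_left : ∀ u, Measurable fun t => cons t u := fun u =>
      hcons.measurable.comp (measurable_id.prodMk measurable_const)
    have hcons_right : ∀ t, Measurable fun u => cons t u := fun t =>
      hcons.measurable.comp (measurable_const.prodMk measurable_id)
    let g : Fin 2 → (∀ i, Λ i) → ℝ := fun y lam =>
      (A 0 0 lam + (-1 : ℝ) ^ (y : ℕ) * A 0 1 lam) / 2
    have hg_meas : ∀ y, Measurable (g y) := fun y =>
      (((hm 0 0).add ((hm 0 1).const_mul _)).div_const 2)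
    have hg_sum : ∀ lam, |g 0 lam| + |g 1 lam| ≤ 1 := by
      intro lam
      have := abs_half_add_add_abs_half_sub_le_one (hv 0 0 lam) (hv 0 1 lam)
      simpa [g, sub_eq_add_neg] using this
    have hg_le : ∀ y lam, |g y lam| ≤ 1 := by
      intro y lam
      have := hg_sum lam
      have h0 := abs_nonneg (g 0 lam)
      have h1 := abs_nonneg (g 1 lam)
      fin_cases y
      · change |g 0 lam| ≤ 1
        linarith
      · change |g 1 lam| ≤ 1
        linarith
    have hg_loc : ∀ y t u u', g y (cons t u) = g y (cons t u') := by
      intro y t u u'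
      have h : ∀ x, A 0 x (cons t u) = A 0 x (cons t u') := by
        intro x
        apply hl
        intro i hi
        have : i = 0 := by
          ext
          simpa using hi
        subst this
        rfl
      simp only [g, h]
    let P : Fin 2 → ℝ := fun y => ∫ t, |g y (cons t u₀)| ∂(ρ 0)
    have hP_int : ∀ y, Integrable (fun t => |g y (cons t u₀)|) (ρ 0) := fun y =>
      (integrable_of_abs_le_one ((hg_meas y).comp (hcons_left u₀)) fun t => hg_le y _).abs
    have hP_nonneg : ∀ y, 0 ≤ P y := fun y => integral_nonneg fun t => abs_nonneg _
    have hP_sum : P 0 + P 1 ≤ 1 := by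
      rw [← integral_add (hP_int 0) (hP_int 1)]
      refine (integral_mono ((hP_int 0).add (hP_int 1)) (integrable_const 1)
        fun t => hg_sum (cons t u₀)).trans ?_
      simp
    let B : Fin 2 → (∀ i : Fin N, Λ i.succ) → ℝ := fun y u =>
      ∫ t, g y (cons t u) * A 1 y (cons t u) ∂(ρ 0)
    have hB_meas : ∀ y, Measurable (B y) := by
      intro y
      have h : Measurable fun q : Λ 0 × (∀ i : Fin N, Λ i.succ) =>
          g y (cons q.1 q.2) * A 1 y (cons q.1 q.2) :=
        ((hg_meas y).comp hcons.measurable).mul ((hm 1 y).comp hcons.measurable)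
      exact (h.stronglyMeasurable.integral_prod_left').measurable
    have hB_le : ∀ y u, |B y u| ≤ P y := by
      intro y u
      refine (abs_integral_le_integral_abs).trans ?_
      refine integral_mono_of_nonneg (ae_of_all _ fun t => abs_nonneg _) (hP_int y)
        (ae_of_all _ fun t => ?_)
      change |g y (cons t u) * A 1 y (cons t u)| ≤ |g y (cons t u₀)|
      rw [abs_mul, hg_loc y t u u₀]
      exact mul_le_of_le_one_right (abs_nonneg _) (hv 1 y _)
    have hB_loc : ∀ y (u u' : ∀ i : Fin N, Λ i.succ),
        (∀ i : Fin N, (i : ℕ) = 0 → u i = u' i) → B y u = B y u' := by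
      intro y u u' h
      refine integral_congr_ae (ae_of_all _ fun t => ?_)
      change g y (cons t u) * A 1 y (cons t u) = g y (cons t u') * A 1 y (cons t u')
      rw [hg_loc y t u u', hl 1 y (cons t u) (cons t u')]
      intro i hi
      induction i using Fin.cases with
      | zero => rfl
      | succ i =>
        refine h i ?_
        have h1 : ((1 : Fin (N + 1 + 1)) : ℕ) = 1 := rfl
        rw [h1, Fin.val_succ] at hi
        omega
    have hrest : ∀ (p : Fin N) x t u,
        A p.succ.succ x (cons t u) = A p.succ.succ x (cons t₀ u) := by
      intro p x t u
      apply hl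
      intro i hi
      induction i using Fin.cases with
      | zero => simp at hi
      | succ i => rfl
    have havg : ∀ y : Fin (N + 1) → Fin 2,
        ∫ u, B (y 0) u * ∏ p : Fin N, A p.succ.succ (y p.succ) (cons t₀ u) ∂μ
          = (-1 : ℝ) ^ (∑ j : Fin N, ((y j.castSucc : ℕ) * (y j.succ : ℕ))) * m := by
      intro y
      let Q : (∀ i, Λ i) → ℝ := fun lam => ∏ p : Fin (N + 1), A p.succ (y p) lam
      have hQ_meas : Measurable Q := Finset.measurable_prod _ fun p _ => hm _ _
      have hQ_le : ∀ lam, |Q lam| ≤ 1 := fun lam => abs_prod_le_one _ fun p => hv _ _ _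
      have hAQ_int : ∀ x, Integrable (fun lam => A 0 x lam * Q lam) (Measure.pi ρ) := by
        intro x
        refine integrable_of_abs_le_one ((hm 0 x).mul hQ_meas) fun lam => ?_
        rw [abs_mul]
        exact mul_le_one₀ (hv _ _ _) (abs_nonneg _) (hQ_le _)
      have hgQ_int : Integrable (fun lam => g (y 0) lam * Q lam) (Measure.pi ρ) := by
        refine integrable_of_abs_le_one ((hg_meas _).mul hQ_meas) fun lam => ?_
        rw [abs_mul]
        exact mul_le_one₀ (hg_le _ _) (abs_nonneg _) (hQ_le _)
      let s : ℝ := (-1 : ℝ) ^ (∑ j : Fin N, ((y j.castSucc : ℕ) * (y j.succ : ℕ)))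
      have hAQ : ∀ x : Fin 2, ∫ lam, A 0 x lam * Q lam ∂(Measure.pi ρ)
          = (-1 : ℝ) ^ ((x : ℕ) * (y 0 : ℕ)) * s * C x := by
        intro x
        have h := hc (Fin.cons x y)
        simp only [Fin.prod_univ_succ (n := N + 1), Fin.sum_univ_succ (n := N),
          Fin.cons_zero, Fin.cons_succ, Fin.castSucc_zero, ← Fin.succ_castSucc, pow_add] at h
        exact h
      have hgQ : ∫ lam, g (y 0) lam * Q lam ∂(Measure.pi ρ) = s * m := by
        have hsplit : (fun lam => g (y 0) lam * Q lam) = fun lam =>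
            (1 / 2 : ℝ) * (A 0 0 lam * Q lam)
              + ((-1 : ℝ) ^ (y 0 : ℕ) / 2) * (A 0 1 lam * Q lam) := by
          funext lam
          simp only [g]
          ring
        rw [hsplit, integral_add ((hAQ_int 0).const_mul _) ((hAQ_int 1).const_mul _),
          integral_const_mul, integral_const_mul, hAQ, hAQ]
        have hsq : (-1 : ℝ) ^ (y 0 : ℕ) * (-1 : ℝ) ^ (y 0 : ℕ) = 1 := by
          rw [← mul_pow]
          simp
        simp only [Fin.val_zero, Fin.val_one, zero_mul, one_mul, pow_zero, hmdef]
        linear_combination (s * C 1 / 2) * hsq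
      rw [← hgQ, ← hcons.map_eq,
        integral_map hcons.measurable.aemeasurable
          (by exact ((hg_meas _).mul hQ_meas).aestronglyMeasurable),
        integral_prod_symm _ (by exact hcons.integrable_comp_of_integrable hgQ_int)]
      refine integral_congr_ae (ae_of_all _ fun u => ?_)
      change (∫ t, g (y 0) (cons t u) * A 1 (y 0) (cons t u) ∂(ρ 0)) * _
        = ∫ t, g (y 0) (cons t u) * Q (cons t u) ∂(ρ 0)
      rw [← integral_mul_const]
      refine integral_congr_ae (ae_of_all _ fun t => ?_)
      simp only [Q, Fin.prod_univ_succ (n := N), hrest _ _ t u, Fin.succ_zero_eq_one, mul_assoc]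
    have hm_zero : ∀ y, P y = 0 → m = 0 := by
      intro y hy
      have hB0 : ∀ u, B y u = 0 := fun u =>
        abs_eq_zero.1 (le_antisymm ((hB_le y u).trans hy.le) (abs_nonneg _))
      have h := havg fun _ => y
      simp only [hB0, zero_mul, integral_zero] at h
      rcases mul_eq_zero.1 h.symm with h | h
      · exact absurd h (pow_ne_zero _ (by norm_num))
      · exact h
    by_cases hm0 : m = 0
    · rw [hm0, abs_zero]
      positivity
    have hP_pos : ∀ y, 0 < P y := fun y =>
      lt_of_le_of_ne (hP_nonneg y) fun h => hm0 (hm_zero y h.symm)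
    let A' : Fin (N + 1) → Fin 2 → (∀ i : Fin N, Λ i.succ) → ℝ := fun p x u =>
      Fin.cases (motive := fun _ => ℝ) (B x u / P x) (fun q => A q.succ.succ x (cons t₀ u)) p
    have hIH := ih (fun i => Λ i.succ) (fun i => ρ i.succ) A' ?_ ?_ ?_ (fun y => m / P y) ?_
    · rw [pow_succ, ← div_eq_mul_inv]
      exact abs_le_half_of_abs_div_add_div_le (hP_pos 0) (hP_pos 1) hP_sum hIH
    · intro p x
      induction p using Fin.cases with
      | zero => exact (hB_meas x).div_const _
      | succ p => exact (hm _ _).comp (hcons_right t₀)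
    · intro p x u
      induction p using Fin.cases with
      | zero =>
        change |B x u / P x| ≤ 1
        rw [abs_div, abs_of_pos (hP_pos x)]
        exact div_le_one_of_le₀ (hB_le x u) (hP_nonneg x)
      | succ p => exact hv _ _ _
    · intro p x u u' h
      induction p using Fin.cases with
      | zero =>
        change B x u / P x = B x u' / P x
        rw [hB_loc x u u' fun i hi => h i (Or.inl hi)]
      | succ p =>
        refine hl _ _ _ _ fun i hi => ?_
        induction i using Fin.cases with
        | zero => rfl
        | succ i =>
          refine h i ?_
          simp only [Fin.val_succ] at hi ⊢
          omega
    · intro y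
      have hprod : ∀ u, ∏ p, A' p (y p) u
          = (B (y 0) u * ∏ p : Fin N, A p.succ.succ (y p.succ) (cons t₀ u)) / P (y 0) := by
        intro u
        rw [Fin.prod_univ_succ]
        change B (y 0) u / P (y 0) * ∏ p : Fin N, A p.succ.succ (y p.succ) (cons t₀ u) = _
        ring
      simp only [hprod]
      rw [integral_div, havg y, mul_div_assoc]

/-- Fix `N ≥ 1` and let a chain-`N`-local model be given: `N` independent sources
`(Λ_i, ρ_i)` in a line connecting `N+1` parties. We encode each party
`p : Fin (N+1)` by a measurable ±1-valued response `A p : {0,1} → (Π i, Λ i) → ℝ`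
which depends only on the variables of the sources adjacent to it in the chain,
namely those `i : Fin N` with `(i : ℕ) = (p : ℕ)` or `(i : ℕ) + 1 = (p : ℕ)`
(the first party sees source `0` only, party `j` (for `2 ≤ j ≤ N`) sees sources `j−1`
and `j`, and the last party sees source `N−1` only, in 1-based numbering).
If there is a real constant `C` such that the correlators satisfy
`⟨a¹_{x¹} ⋯ a^{N+1}_{x^{N+1}}⟩ = (−1)^{x¹x² + ⋯ + x^N x^{N+1}} · C` for all inputs,
then `|C| ≤ 2^{−N}`. In particular, correlations of this form with `C = V/2^{N/2}`
force `V ≤ 2^{−N/2}` (so they cannot be reproduced when `V > 2^{−N/2}`). -/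
theorem chain_network_local_bound
    (N : ℕ) (hN : 1 ≤ N)
    (Λ : Fin N → Type) [∀ i, MeasurableSpace (Λ i)]
    (ρ : ∀ i, Measure (Λ i)) [∀ i, IsProbabilityMeasure (ρ i)]
    (A : Fin (N+1) → Fin 2 → (∀ i, Λ i) → ℝ)
    (hA_meas : ∀ p x, Measurable (A p x))
    (hA_val : ∀ p x lam, A p x lam = 1 ∨ A p x lam = -1)
    (hA_loc : ∀ (p : Fin (N+1)) (x : Fin 2) (lam lam' : ∀ i, Λ i),
      (∀ i : Fin N, ((i : ℕ) = (p : ℕ) ∨ (i : ℕ) + 1 = (p : ℕ)) → lam i = lam' i) →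
      A p x lam = A p x lam')
    (C : ℝ)
    (hcorr : ∀ x : Fin (N+1) → Fin 2,
      (∫ lam, ∏ p, A p (x p) lam ∂(Measure.pi ρ))
        = (-1 : ℝ) ^ (∑ j : Fin N, ((x j.castSucc : ℕ) * (x j.succ : ℕ))) * C) :
    |C| ≤ (2 : ℝ)⁻¹ ^ N
      ∧ ∀ V : ℝ, C = V / (2 : ℝ) ^ ((N : ℝ) / 2) → V ≤ (2 : ℝ) ^ (-(N : ℝ) / 2) := by
  have hC : |C| ≤ (2 : ℝ)⁻¹ ^ N := by
    have h := chain_amplitude_bound N Λ ρ A hA_meas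
      (fun p x lam => by rcases hA_val p x lam with h | h <;> simp [h]) hA_loc (fun _ => C) hcorr
    simpa using h
  refine ⟨hC, fun V hV => ?_⟩
  have hpos : (0 : ℝ) < (2 : ℝ) ^ ((N : ℝ) / 2) := by positivity
  have hV' : V = C * (2 : ℝ) ^ ((N : ℝ) / 2) := by
    rw [hV, div_mul_cancel₀ _ hpos.ne']
  have hpow : (2 : ℝ) ^ (-(N : ℝ) / 2) = (2 : ℝ)⁻¹ ^ N * (2 : ℝ) ^ ((N : ℝ) / 2) := by
    rw [inv_pow, ← Real.rpow_natCast, ← Real.rpow_neg (by norm_num),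
      ← Real.rpow_add (by norm_num)]
    congr 1
    ring
  rw [hV', hpow]
  exact mul_le_mul_of_nonneg_right ((le_abs_self C).trans hC) hpos.le
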